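/- arXiv:2002.04996 — 2 statements merged into one kernel-verified Lean document; each statement's English description precedes it below -/
import Mathlib

section
/- Let Ω be a probability space, p ≥ 1, and let C : Ω → Matrix (Fin p) (Fin p) ℝ be a random real symmetric p×p matrix such that C, tr(C)·C, tr(C²) and tr(C)² are integrable, with M₀ := E[C] and η₀ := tr(M₀)/p. Assume E[‖C − (tr(C)/p)·I‖_F²] > 0. Then the function β ↦ E[‖β·C + (1−β)·(tr(C)/p)·I − M₀‖_F²] over β ∈ ℝ is uniquely minimized at β₀ = ‖M₀ − η₀·I‖_F² / E[‖C − (tr(C)/p)·I‖_F²], and β₀ ∈ [0, 1]. -/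
open MeasureTheory ProbabilityTheory Matrix

/-- Squared Frobenius norm of a real matrix: `‖A‖_F² = tr(AᵀA)`. -/
noncomputable def frobSq {p : ℕ} (A : Matrix (Fin p) (Fin p) ℝ) : ℝ := (Aᵀ * A).trace

theorem frobSq_nonneg {p : ℕ} (A : Matrix (Fin p) (Fin p) ℝ) : 0 ≤ frobSq A := by
  simp only [frobSq, Matrix.trace, Matrix.diag, Matrix.mul_apply, Matrix.transpose_apply]
  exact Finset.sum_nonneg fun i _ => Finset.sum_nonneg fun j _ => mul_self_nonneg _

theorem frobSq_sub {p : ℕ} (A B : Matrix (Fin p) (Fin p) ℝ) :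
    frobSq (A - B) = frobSq A - 2 * (Bᵀ * A).trace + frobSq B := by
  have h : (Aᵀ * B).trace = (Bᵀ * A).trace := by
    rw [← Matrix.trace_transpose, Matrix.transpose_mul, Matrix.transpose_transpose]
  simp only [frobSq, Matrix.transpose_sub, Matrix.sub_mul, Matrix.mul_sub, Matrix.trace_sub, h]
  ring

theorem frobSq_smul {p : ℕ} (c : ℝ) (A : Matrix (Fin p) (Fin p) ℝ) :
    frobSq (c • A) = c ^ 2 * frobSq A := by
  simp only [frobSq, Matrix.transpose_smul, Matrix.smul_mul, Matrix.mul_smul, Matrix.trace_smul,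
    smul_eq_mul]
  ring

theorem frobSq_one {p : ℕ} : frobSq (1 : Matrix (Fin p) (Fin p) ℝ) = p := by
  simp [frobSq]

theorem trace_transpose_mul_sub_smul_one {p : ℕ} {B : Matrix (Fin p) (Fin p) ℝ}
    (hB : B.trace = 0) (A : Matrix (Fin p) (Fin p) ℝ) (c : ℝ) :
    (Bᵀ * (A - c • (1 : Matrix (Fin p) (Fin p) ℝ))).trace = (Bᵀ * A).trace := by
  rw [Matrix.mul_sub, Matrix.trace_sub, Matrix.mul_smul, Matrix.mul_one, Matrix.trace_smul,
    Matrix.trace_transpose, hB, smul_zero, sub_zero]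

theorem trace_sub_trace_div_smul_one {p : ℕ} (hp : 1 ≤ p) (A : Matrix (Fin p) (Fin p) ℝ) :
    (A - (A.trace / p) • (1 : Matrix (Fin p) (Fin p) ℝ)).trace = 0 := by
  have : (p : ℝ) ≠ 0 := by positivity
  simp only [Matrix.trace_sub, Matrix.trace_smul, Matrix.trace_one, Fintype.card_fin, smul_eq_mul]
  field_simp
  ring

theorem frobSq_sub_trace_div_smul_one {p : ℕ} (hp : 1 ≤ p) (A : Matrix (Fin p) (Fin p) ℝ) :
    frobSq (A - (A.trace / p) • (1 : Matrix (Fin p) (Fin p) ℝ)) =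
      frobSq A - A.trace ^ 2 / p := by
  have : (p : ℝ) ≠ 0 := by positivity
  rw [frobSq_sub, frobSq_smul, frobSq_one]
  simp only [Matrix.transpose_smul, Matrix.transpose_one, Matrix.smul_mul, Matrix.one_mul,
    Matrix.trace_smul, smul_eq_mul]
  field_simp
  ring

/-- Orthogonal decomposition of the shrinkage loss into its traceless part and its part along the
identity matrix. -/
theorem frobSq_shrinkage_sub {p : ℕ} (hp : 1 ≤ p) (A M : Matrix (Fin p) (Fin p) ℝ) (β : ℝ) :
    frobSq (β • A + (1 - β) • ((A.trace / p) • (1 : Matrix (Fin p) (Fin p) ℝ)) - M) =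
      β ^ 2 * frobSq (A - (A.trace / p) • (1 : Matrix (Fin p) (Fin p) ℝ))
        - 2 * β * ((M - (M.trace / p) • (1 : Matrix (Fin p) (Fin p) ℝ))ᵀ * A).trace
        + frobSq (M - (M.trace / p) • (1 : Matrix (Fin p) (Fin p) ℝ))
        + (A.trace - M.trace) ^ 2 / p := by
  have hp0 : (p : ℝ) ≠ 0 := by positivity
  set S := A - (A.trace / p) • (1 : Matrix (Fin p) (Fin p) ℝ) with hS
  set N := M - (M.trace / p) • (1 : Matrix (Fin p) (Fin p) ℝ) with hN
  have hSt : S.trace = 0 := trace_sub_trace_div_smul_one hp A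
  have hNt : N.trace = 0 := trace_sub_trace_div_smul_one hp M
  have hA : (Nᵀ * A).trace = (Nᵀ * S).trace :=
    (trace_transpose_mul_sub_smul_one hNt A _).symm
  have hdecomp : β • A + (1 - β) • ((A.trace / p) • (1 : Matrix (Fin p) (Fin p) ℝ)) - M =
      (β • S - N) - ((M.trace - A.trace) / p) • (1 : Matrix (Fin p) (Fin p) ℝ) := by
    rw [hS, hN]
    module
  rw [hdecomp, hA, frobSq_sub, frobSq_sub, frobSq_smul, frobSq_smul, frobSq_one]
  simp only [Matrix.transpose_smul, Matrix.transpose_one, Matrix.smul_mul, Matrix.mul_smul,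
    Matrix.one_mul, Matrix.trace_smul, Matrix.trace_sub, hSt, hNt, smul_eq_mul]
  field_simp
  ring

theorem integrable_trace_mul {Ω : Type*} [MeasurableSpace Ω] {μ : Measure Ω} {p : ℕ}
    (B : Matrix (Fin p) (Fin p) ℝ) {C : Ω → Matrix (Fin p) (Fin p) ℝ}
    (hC : ∀ a b, Integrable (fun ω => C ω a b) μ) :
    Integrable (fun ω => (B * C ω).trace) μ := by
  simp only [Matrix.trace, Matrix.diag, Matrix.mul_apply]
  exact integrable_finsetSum _ fun i _ => integrable_finsetSum _ fun j _ =>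
    (hC j i).const_mul _

theorem integral_trace_mul {Ω : Type*} [MeasurableSpace Ω] {μ : Measure Ω} {p : ℕ}
    (B M : Matrix (Fin p) (Fin p) ℝ) {C : Ω → Matrix (Fin p) (Fin p) ℝ}
    (hC : ∀ a b, Integrable (fun ω => C ω a b) μ) (hM : ∀ a b, M a b = ∫ ω, C ω a b ∂μ) :
    ∫ ω, (B * C ω).trace ∂μ = (B * M).trace := by
  simp only [Matrix.trace, Matrix.diag, Matrix.mul_apply]
  refine (integral_finsetSum _ fun i _ => integrable_finsetSum _ fun j _ =>
    (hC j i).const_mul _).trans (Finset.sum_congr rfl fun i _ => ?_)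
  refine (integral_finsetSum _ fun j _ => (hC j i).const_mul _).trans
    (Finset.sum_congr rfl fun j _ => ?_)
  rw [integral_const_mul, hM]

/-- **Theorem 1 (minimizer formula, equation (11)).** For a random symmetric `p×p` matrix `C`
with mean `M₀ = E[C]`, `η₀ = tr(M₀)/p`, and `E[‖C − (tr(C)/p)·I‖_F²] > 0`, the MSE
`β ↦ E[‖β·C + (1−β)·(tr(C)/p)·I − M₀‖_F²]` is uniquely minimized over `β ∈ ℝ` at
`β₀ = ‖M₀ − η₀·I‖_F² / E[‖C − (tr(C)/p)·I‖_F²]`, and `β₀ ∈ [0,1]`. -/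
theorem shrinkage_mse_unique_minimizer
    {Ω : Type*} [MeasureSpace Ω] [IsProbabilityMeasure (ℙ : Measure Ω)]
    {p : ℕ} (hp : 1 ≤ p)
    (C : Ω → Matrix (Fin p) (Fin p) ℝ)
    (hCsymm : ∀ ω, (C ω).IsSymm)
    (hCint : ∀ a b, Integrable (fun ω => C ω a b))
    (htrCCint : ∀ a b, Integrable (fun ω => (C ω).trace * C ω a b))
    (htrC2int : Integrable (fun ω => (C ω * C ω).trace))
    (htrCsqint : Integrable (fun ω => (C ω).trace ^ 2))
    (M₀ : Matrix (Fin p) (Fin p) ℝ) (hM₀ : ∀ a b, M₀ a b = ∫ ω, C ω a b)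
    (η₀ : ℝ) (hη₀ : η₀ = M₀.trace / p)
    (hden : 0 < ∫ ω, frobSq (C ω - ((C ω).trace / p) • (1 : Matrix (Fin p) (Fin p) ℝ)))
    (β₀ : ℝ)
    (hβ₀ : β₀ = frobSq (M₀ - η₀ • (1 : Matrix (Fin p) (Fin p) ℝ))
        / ∫ ω, frobSq (C ω - ((C ω).trace / p) • (1 : Matrix (Fin p) (Fin p) ℝ))) :
    (∀ β : ℝ, β ≠ β₀ →
      (∫ ω, frobSq (β₀ • C ω + (1 - β₀) • (((C ω).trace / p) • (1 : Matrix (Fin p) (Fin p) ℝ))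
          - M₀))
        < ∫ ω, frobSq (β • C ω + (1 - β) • (((C ω).trace / p) • (1 : Matrix (Fin p) (Fin p) ℝ))
          - M₀)) ∧
    β₀ ∈ Set.Icc (0 : ℝ) 1 := by
  set D := ∫ ω, frobSq (C ω - ((C ω).trace / p) • (1 : Matrix (Fin p) (Fin p) ℝ)) with hD
  subst hη₀
  set N := M₀ - (M₀.trace / p) • (1 : Matrix (Fin p) (Fin p) ℝ) with hN
  have hNt : N.trace = 0 := trace_sub_trace_div_smul_one hp M₀
  have hS : Integrable fun ω =>
      frobSq (C ω - ((C ω).trace / p) • (1 : Matrix (Fin p) (Fin p) ℝ)) := by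
    simp only [frobSq_sub_trace_div_smul_one hp]
    simp only [frobSq, (hCsymm _).eq]
    exact htrC2int.sub (htrCsqint.div_const _)
  have hNC : Integrable fun ω => (Nᵀ * C ω).trace := integrable_trace_mul _ hCint
  have htr : Integrable fun ω => (C ω).trace := by
    simpa using integrable_trace_mul 1 hCint
  have hvar : Integrable fun ω => ((C ω).trace - M₀.trace) ^ 2 / p := by
    simp only [sub_sq]
    exact ((htrCsqint.sub ((htr.const_mul 2).mul_const _)).add (integrable_const _)).div_const _
  have hNM : ∫ ω, (Nᵀ * C ω).trace = frobSq N := by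
    rw [integral_trace_mul _ M₀ hCint hM₀, frobSq]
    exact (trace_transpose_mul_sub_smul_one hNt M₀ _).symm
  have hlin (β : ℝ) : Integrable fun ω => β ^ 2 * frobSq (C ω - ((C ω).trace / p) •
      (1 : Matrix (Fin p) (Fin p) ℝ)) - 2 * β * (Nᵀ * C ω).trace :=
    (hS.const_mul _).sub (hNC.const_mul _)
  have hquad (β : ℝ) : ∫ ω, (β ^ 2 * frobSq (C ω - ((C ω).trace / p) •
      (1 : Matrix (Fin p) (Fin p) ℝ)) - 2 * β * (Nᵀ * C ω).trace + frobSq N) =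
      β ^ 2 * D - 2 * β * frobSq N + frobSq N := by
    rw [integral_add (hlin β) (integrable_const _), integral_sub (hS.const_mul _) (hNC.const_mul _),
      integral_const_mul, integral_const_mul, hNM]
    simp [hD]
  have hmse (β : ℝ) : ∫ ω, frobSq (β • C ω + (1 - β) • (((C ω).trace / p) •
      (1 : Matrix (Fin p) (Fin p) ℝ)) - M₀) =
      β ^ 2 * D - 2 * β * frobSq N + frobSq N + ∫ ω, ((C ω).trace - M₀.trace) ^ 2 / p := by
    simp only [frobSq_shrinkage_sub hp]
    rw [← hquad]
    exact integral_add ((hlin β).add (integrable_const _)) hvar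
  have hle : frobSq N ≤ D := by
    have h : 0 ≤ ∫ ω, (1 ^ 2 * frobSq (C ω - ((C ω).trace / p) •
        (1 : Matrix (Fin p) (Fin p) ℝ)) - 2 * 1 * (Nᵀ * C ω).trace + frobSq N) := by
      refine integral_nonneg fun ω => ?_
      have hdev := frobSq_nonneg (C ω - ((C ω).trace / p) •
        (1 : Matrix (Fin p) (Fin p) ℝ) - N)
      rw [frobSq_sub, trace_transpose_mul_sub_smul_one hNt] at hdev
      simpa using hdev
    rw [hquad] at h
    linarith
  have hβD : β₀ * D = frobSq N := by
    rw [hβ₀]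
    exact div_mul_cancel₀ _ hden.ne'
  refine ⟨fun β hβ => ?_, ?_, ?_⟩
  · rw [hmse, hmse, ← hβD]
    have : 0 < (β - β₀) ^ 2 * D := mul_pos (sq_pos_of_ne_zero (sub_ne_zero.mpr hβ)) hden
    linarith
  · rw [hβ₀]
    exact div_nonneg (frobSq_nonneg _) hden.le
  · rw [hβ₀]
    exact (div_le_one hden).mpr hle
end

section
/- Fix integers p ≥ 2 and n ≥ 1, a real symmetric p×p matrix M₀ with tr(M₀) > 0, and a real number ψ₁ > 0. Let T₁ := tr(M₀), T₂ := tr(M₀²), γ := p·T₂/T₁², η₀ := T₁/p, and suppose γ > 1 or (γ = 1 and the denominators below are nonzero). If E₂ := (1 + (2ψ₁ − 1)/n)·T₂ + (ψ₁/n)·T₁² and E₁ := (2ψ₁/n)·T₂ + (1 + (ψ₁ − 1)/n)·T₁², then p·(γ − 1)·η₀² / (E₂ − E₁/p) = (γ − 1) / ((γ − 1)·(1 − 1/n) + ψ₁·(1 − 1/p)·(2γ + p)/n), provided both denominators are nonzero. -/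
open Matrix

/-- **Algebraic identity proving Theorem 2.** Substituting the moment formulas of Lemma 1,
`E₂ = (1 + (2ψ₁−1)/n)·tr(M₀²) + (ψ₁/n)·tr(M₀)²` and
`E₁ = (2ψ₁/n)·tr(M₀²) + (1 + (ψ₁−1)/n)·tr(M₀)²`, into the oracle formula
`β₀ = p(γ−1)η₀²/(E₂ − E₁/p)` of Theorem 1 yields the closed form
`(γ−1)/((γ−1)(1−1/n) + ψ₁(1−1/p)(2γ+p)/n)`, where `γ = p·tr(M₀²)/tr(M₀)²` is the
sphericity and `η₀ = tr(M₀)/p`. -/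
theorem oracle_shrinkage_closed_form
    {p n : ℕ} (hp : 2 ≤ p) (hn : 1 ≤ n)
    (M₀ : Matrix (Fin p) (Fin p) ℝ) (hMsymm : M₀.IsSymm) (htr : 0 < M₀.trace)
    (ψ₁ : ℝ) (hψ₁ : 0 < ψ₁)
    (T₁ T₂ γ η₀ E₂ E₁ : ℝ)
    (hT₁ : T₁ = M₀.trace) (hT₂ : T₂ = (M₀ * M₀).trace)
    (hγ : γ = p * T₂ / T₁ ^ 2) (hη₀ : η₀ = T₁ / p)
    (hγ1 : 1 < γ ∨ γ = 1)
    (hE₂ : E₂ = (1 + (2 * ψ₁ - 1) / n) * T₂ + (ψ₁ / n) * T₁ ^ 2)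
    (hE₁ : E₁ = (2 * ψ₁ / n) * T₂ + (1 + (ψ₁ - 1) / n) * T₁ ^ 2)
    (hden₁ : E₂ - E₁ / p ≠ 0)
    (hden₂ : (γ - 1) * (1 - 1 / n) + ψ₁ * (1 - 1 / p) * (2 * γ + p) / n ≠ 0) :
    p * (γ - 1) * η₀ ^ 2 / (E₂ - E₁ / p)
      = (γ - 1) / ((γ - 1) * (1 - 1 / n) + ψ₁ * (1 - 1 / p) * (2 * γ + p) / n) := by
  have hp0 : (p : ℝ) ≠ 0 := by positivity
  have hn0 : (n : ℝ) ≠ 0 := by positivity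
  have hT₁0 : T₁ ≠ 0 := hT₁ ▸ htr.ne'
  have hT₂γ : T₂ = γ * T₁ ^ 2 / p := by
    rw [hγ]
    field_simp
  have hden : E₂ - E₁ / p = T₁ ^ 2 / p *
      ((γ - 1) * (1 - 1 / n) + ψ₁ * (1 - 1 / p) * (2 * γ + p) / n) := by
    rw [hE₂, hE₁, hT₂γ]
    field_simp
    ring
  have hnum : p * (γ - 1) * η₀ ^ 2 = T₁ ^ 2 / p * (γ - 1) := by
    rw [hη₀]
    field_simp
  rw [hden, hnum, mul_div_mul_left _ _ (by positivity)]
end
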